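/- The line integral of G(z)·τ(z) along the straight segment γ from x to y (for x, y ∈ ℝ² nonzero with x, y, 0 not collinear in the degenerate sense that |x||y| + x·y ≠ 0) equals I(x,y) = (1/(|x||y| + x·y)) · (x/|x| + y/|y|)ᵀ M (y - x), where M is the matrix with rows (0, -1) and (1-ν, 0). -/

import Mathlib

open Real Set

noncomputable def nrm (z : ℝ × ℝ) : ℝ := Real.sqrt (z.1 ^ 2 + z.2 ^ 2)

def dot (a b : ℝ × ℝ) : ℝ := a.1 * b.1 + a.2 * b.2

/-- The kernel `G(z) = ((1-ν) z₂ / |z|³, -z₁ / |z|³)`. -/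
noncomputable def G (ν : ℝ) (z : ℝ × ℝ) : ℝ × ℝ :=
  ((1 - ν) * z.2 / (nrm z) ^ 3, -z.1 / (nrm z) ^ 3)

/-- Application of the matrix `M = [[0,-1],[1-ν,0]]` to a vector. -/
def Mmul (ν : ℝ) (v : ℝ × ℝ) : ℝ × ℝ := (-v.2, (1 - ν) * v.1)

theorem nrm_sq (z : ℝ × ℝ) : nrm z ^ 2 = z.1 ^ 2 + z.2 ^ 2 :=
  Real.sq_sqrt (by positivity)

theorem nrm_pos {z : ℝ × ℝ} (hz : z ≠ 0) : 0 < nrm z := by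
  apply Real.sqrt_pos.2
  by_contra! h
  exact hz (Prod.ext (by simp; nlinarith [sq_nonneg z.1, sq_nonneg z.2])
    (by simp; nlinarith [sq_nonneg z.1, sq_nonneg z.2]))

/-- If `y` is not on the ray opposite to `x`, neither is any point of the segment from `x` to `y`. -/
theorem nrm_mul_add_dot_segment_pos {x y : ℝ × ℝ} (hx : x ≠ 0)
    (hpos : 0 < nrm x * nrm y + dot x y) {t : ℝ} (ht : t ∈ Icc (0 : ℝ) 1)
    (hz : x + t • (y - x) ≠ 0) :
    0 < nrm x * nrm (x + t • (y - x)) + dot x (x + t • (y - x)) := by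
  have ha := nrm_pos hx
  have hr := nrm_pos hz
  have hmul := mul_pos ha hr
  have hlin : dot x (x + t • (y - x)) = (1 - t) * nrm x ^ 2 + t * dot x y := by
    rw [nrm_sq]; simp [dot]; ring
  have hlag : (nrm x * nrm y) ^ 2 - dot x y ^ 2 = (x.1 * y.2 - x.2 * y.1) ^ 2 := by
    rw [mul_pow, nrm_sq, nrm_sq]; simp only [dot]; ring
  have hlag' : (nrm x * nrm (x + t • (y - x))) ^ 2 - dot x (x + t • (y - x)) ^ 2 =
      t ^ 2 * (x.1 * y.2 - x.2 * y.1) ^ 2 := by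
    rw [mul_pow, nrm_sq, nrm_sq]; simp [dot]; ring
  rcases lt_or_ge 0 (dot x (x + t • (y - x))) with h | h
  · positivity
  have ht0 : t ≠ 0 := by
    rintro rfl
    rw [hlin] at h
    nlinarith [sq_pos_of_pos ha]
  have hcross : x.1 * y.2 - x.2 * y.1 ≠ 0 := by
    intro h0
    rw [h0] at hlag
    have hfac : (nrm x * nrm y + dot x y) * (nrm x * nrm y - dot x y) = 0 := by
      linear_combination hlag
    have hxy : nrm x * nrm y = dot x y := by
      have := (mul_eq_zero.1 hfac).resolve_left hpos.ne'
      linarith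
    have hxy_pos : 0 < dot x y := by linarith
    have htpos : 0 < t := lt_of_le_of_ne ht.1 (Ne.symm ht0)
    rw [hlin] at h
    have := mul_pos htpos hxy_pos
    have := mul_nonneg (sub_nonneg.2 ht.2) (sq_nonneg (nrm x))
    linarith
  have : 0 < t ^ 2 * (x.1 * y.2 - x.2 * y.1) ^ 2 := by positivity
  nlinarith

theorem hasDerivAt_nrm_segment {x d : ℝ × ℝ} {t : ℝ} (hz : x + t • d ≠ 0) :
    HasDerivAt (fun s : ℝ => nrm (x + s • d)) (dot (x + t • d) d / nrm (x + t • d)) t := by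
  have hr := nrm_pos hz
  have h1 : HasDerivAt (fun s : ℝ => x.1 + s * d.1) d.1 t := by
    simpa using ((hasDerivAt_id t).mul_const d.1).const_add x.1
  have h2 : HasDerivAt (fun s : ℝ => x.2 + s * d.2) d.2 t := by
    simpa using ((hasDerivAt_id t).mul_const d.2).const_add x.2
  have hne : (x.1 + t * d.1) ^ 2 + (x.2 + t * d.2) ^ 2 ≠ 0 := by
    have := nrm_sq (x + t • d)
    simp only [Prod.fst_add, Prod.snd_add, Prod.smul_fst, Prod.smul_snd, smul_eq_mul] at this
    rw [← this]
    positivity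
  refine (((h1.pow 2).add (h2.pow 2)).sqrt hne).congr_deriv ?_
  change _ / (2 * nrm (x + t • d)) = _
  rw [div_eq_div_iff (by positivity) (by positivity)]
  simp [dot]
  ring

/-- A primitive of `(A + t B) / |x + t d|³`, where `A + t B` stands for any linear functional
of `x + t d`, that stays regular when `x` and `d` are collinear. -/
theorem hasDerivAt_segment_primitive {x d : ℝ × ℝ} (A B : ℝ) {t : ℝ} (hx : x ≠ 0)
    (hz : x + t • d ≠ 0) (hS : 0 < nrm x * nrm (x + t • d) + dot x (x + t • d)) :
    HasDerivAt (fun s : ℝ => s * (A / nrm x + (A + s * B) / nrm (x + s • d)) /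
        (nrm x * nrm (x + s • d) + dot x (x + s • d)))
      ((A + t * B) / nrm (x + t • d) ^ 3) t := by
  have ha := nrm_pos hx
  have hr := nrm_pos hz
  have hlin : HasDerivAt (fun s : ℝ => A + s * B) B t := by
    simpa using ((hasDerivAt_id t).mul_const B).const_add A
  have hdot : HasDerivAt (fun s : ℝ => dot x (x + s • d)) (dot x d) t := by
    have : (fun s : ℝ => dot x (x + s • d)) = fun s : ℝ => dot x x + s * dot x d := by
      funext s; simp [dot]; ring
    rw [this]
    simpa using ((hasDerivAt_id t).mul_const (dot x d)).const_add (dot x x)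
  have hnrm := hasDerivAt_nrm_segment hz
  have htr : t * dot (x + t • d) d = nrm (x + t • d) ^ 2 - dot x (x + t • d) := by
    rw [nrm_sq]; simp [dot]; ring
  have htd : t * dot x d = dot x (x + t • d) - nrm x ^ 2 := by
    rw [nrm_sq]; simp [dot]; ring
  refine (((hasDerivAt_id t).mul ((hlin.div hnrm hr.ne').const_add (A / nrm x))).div
    ((hnrm.const_mul (nrm x)).add hdot) hS.ne').congr_deriv ?_
  simp only [id, Pi.mul_apply, Pi.add_apply, Pi.div_apply]
  generalize nrm (x + t • d) = r at *
  generalize nrm x = a at *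
  generalize dot x (x + t • d) = p at *
  generalize dot (x + t • d) d = q at *
  generalize dot x d = e at *
  have hS' := hS.ne'
  have hden : t * (a * (q / r) + e) = (r - a) * (a * r + p) / r := by
    field_simp
    linear_combination a * htr + r * htd
  have hnum : t * ((B * r - (A + t * B) * (q / r)) / r ^ 2) =
      t * B / r - (A + t * B) * (r ^ 2 - p) / r ^ 3 := by
    rw [← htr]; field_simp
  have hsplit : (1 * (A / a + (A + t * B) / r) + t * ((B * r - (A + t * B) * (q / r)) / r ^ 2)) *
      (a * r + p) - t * (A / a + (A + t * B) / r) * (a * (q / r) + e) =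
      (A + t * B) / r ^ 3 * (a * r + p) ^ 2 := by
    rw [hnum, show t * (A / a + (A + t * B) / r) * (a * (q / r) + e) =
      (A / a + (A + t * B) / r) * (t * (a * (q / r) + e)) by ring, hden]
    field_simp
    ring
  rw [hsplit]
  exact mul_div_cancel_right₀ _ (pow_ne_zero 2 hS')

theorem segment_integral_formula (ν : ℝ) (x y : ℝ × ℝ)
    (hx : x ≠ 0) (hy : y ≠ 0)
    (hseg : ∀ t : ℝ, t ∈ Icc (0 : ℝ) 1 → x + t • (y - x) ≠ 0)
    (hpos : 0 < nrm x * nrm y + dot x y) :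
    (∫ t in (0 : ℝ)..1, dot (G ν (x + t • (y - x))) (y - x)) =
      (1 / (nrm x * nrm y + dot x y)) *
        dot ((nrm x)⁻¹ • x + (nrm y)⁻¹ • y) (Mmul ν (y - x)) := by
  have hu : uIcc (0 : ℝ) 1 = Icc 0 1 := uIcc_of_le zero_le_one
  set d := y - x with hd
  have hxd : x + d = y := by simp [d]
  have hfun : ∀ t : ℝ, dot (G ν (x + t • d)) d =
      (dot x (Mmul ν d) + t * dot d (Mmul ν d)) / nrm (x + t • d) ^ 3 := by
    intro t
    simp [dot, G, Mmul]
    ring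
  simp only [hfun]
  rw [intervalIntegral.integral_eq_sub_of_hasDerivAt
    (fun t ht => hasDerivAt_segment_primitive (dot x (Mmul ν d)) (dot d (Mmul ν d)) hx
      (hseg t (hu ▸ ht)) (nrm_mul_add_dot_segment_pos hx hpos (hu ▸ ht) (hseg t (hu ▸ ht))))]
  · have hy' : dot x (Mmul ν d) + dot d (Mmul ν d) = dot y (Mmul ν d) := by
      rw [← hxd]; simp [dot]; ring
    simp only [one_smul, hxd, one_mul, zero_mul, zero_div, sub_zero, hy']
    simp [dot]
    ring
  · apply ContinuousOn.intervalIntegrable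
    rw [hu]
    refine ContinuousOn.div (by fun_prop) ?_ fun t ht => (pow_pos (nrm_pos (hseg t ht)) 3).ne'
    exact ContinuousOn.pow
      (fun t ht => (hasDerivAt_nrm_segment (hseg t ht)).continuousAt.continuousWithinAt) 3
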